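/- Let B_2 and B_3 be nonempty finite words over an alphabet with gcd(|B_2|, |B_3|) = 1, set g = 2|B_2||B_3|, let W be any finite word, let u be a factor of B_2 and let v be a factor of B_3. Then for every natural number r with |W| + g + |B_2| + |B_3| ≤ r ≤ |W| + 5g|B_2| + 5g|B_3| − g − |B_2| − |B_3|, the word B_2^{5g} * W * B_3^{5g} has a factor w with |w| = r of the form w = u * m * v for some (possibly empty) word m. -/

import Mathlib

open Finset MeasureTheory

namespace IETPaper

/-- The first index `0` of `Fin d` (corresponding to `1` in `{1,…,d}`). -/
def firstIdx (d : ℕ) [NeZero d] : Fin d := ⟨0, Nat.pos_of_ne_zero (NeZero.ne d)⟩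

/-- The last index `d-1` of `Fin d` (corresponding to `d` in `{1,…,d}`). -/
def lastIdx (d : ℕ) [NeZero d] : Fin d :=
  ⟨d - 1, Nat.sub_lt (Nat.pos_of_ne_zero (NeZero.ne d)) one_pos⟩

/-- Left endpoint `l₁ + ⋯ + l_{j-1}` of the `j`-th interval `I_j`. -/
noncomputable def leftEnd {d : ℕ} (L : Fin d → ℝ) (j : Fin d) : ℝ :=
  ∑ k ∈ Finset.univ.filter (fun k => k < j), L k

/-- The interval exchange transformation `T_{L,π}`: on the interval
`I_j = [leftEnd L j, leftEnd L j + L j)` it is the translation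
`x ↦ x - ∑_{k < j} l_k + ∑_{π k' < π j} l_{k'}`; elsewhere it is the identity. -/
noncomputable def ietMap {d : ℕ} (π : Equiv.Perm (Fin d)) (L : Fin d → ℝ) (x : ℝ) : ℝ :=
  if h : ∃ j : Fin d, x ∈ Set.Ico (leftEnd L j) (leftEnd L j + L j) then
    x - leftEnd L h.choose + ∑ k ∈ Finset.univ.filter (fun k => π k < π h.choose), L k
  else x

/-- Topological mixing of `T` on the subspace `X ⊆ ℝ` (with its subspace topology:
open sets of `X` are exactly the sets `U ∩ X` with `U` open in `ℝ`). -/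
def TopMixingOn (T : ℝ → ℝ) (X : Set ℝ) : Prop :=
  ∀ U V : Set ℝ, IsOpen U → IsOpen V → (U ∩ X).Nonempty → (V ∩ X).Nonempty →
    ∃ N : ℕ, ∀ n : ℕ, N ≤ n → ((T^[n] '' (U ∩ X)) ∩ (V ∩ X)).Nonempty

/-- Irreducibility of a permutation: `π {1,…,k} ≠ {1,…,k}` for all `k < d`
(0-indexed: `π` does not preserve `{j | j < k}` for `0 < k < d`). -/
def IsIrreducible {d : ℕ} (π : Equiv.Perm (Fin d)) : Prop :=
  ∀ k : ℕ, 0 < k → k < d →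
    (⇑π '' {j : Fin d | (j : ℕ) < k}) ≠ {j : Fin d | (j : ℕ) < k}

/-- A permutation of `{1,…,d}` (written 0-indexed on `Fin d`) is degenerate if for some
`1 ≤ j < d` (0-indexed: `j + 1 < d`) one of the four listed conditions holds. -/
def IsDegenerate {d : ℕ} (π : Equiv.Perm (Fin d)) : Prop :=
  ∃ j : ℕ, ∃ hj : j + 1 < d,
    ((π ⟨j + 1, hj⟩ : ℕ) = (π ⟨j, by omega⟩ : ℕ) + 1) ∨
    ((π ⟨j, by omega⟩ : ℕ) = d - 1 ∧ (π ⟨j + 1, hj⟩ : ℕ) = 0 ∧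
      (π ⟨0, by omega⟩ : ℕ) = (π ⟨d - 1, by omega⟩ : ℕ) + 1) ∨
    ((π ⟨j + 1, hj⟩ : ℕ) = 0 ∧ (π ⟨0, by omega⟩ : ℕ) = (π ⟨j, by omega⟩ : ℕ) + 1) ∨
    ((π ⟨j + 1, hj⟩ : ℕ) = (π ⟨d - 1, by omega⟩ : ℕ) + 1 ∧ (π ⟨j, by omega⟩ : ℕ) = d - 1)

/-- The Keane condition (idoc): the forward orbits of the interior discontinuities
`δ_i = leftEnd L i` (`i ≠ 0`) are pairwise disjoint infinite sets. -/
def KeaneCondition {d : ℕ} (π : Equiv.Perm (Fin d)) (L : Fin d → ℝ) : Prop :=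
  ∀ i j : Fin d, (i : ℕ) ≠ 0 → (j : ℕ) ≠ 0 → ∀ m n : ℕ,
    (ietMap π L)^[m] (leftEnd L i) = (ietMap π L)^[n] (leftEnd L j) → i = j ∧ m = n

/-- `w` is an allowed block for `T_{L,π}`: some point `x` satisfies
`T^{i+1} x ∈ I_{w i}` for all positions `i` of `w` (i.e. `x ∈ ⋂ T^{-i} I_{a_i}`). -/
def IsAllowedBlock {d : ℕ} (π : Equiv.Perm (Fin d)) (L : Fin d → ℝ)
    (w : List (Fin d)) : Prop :=
  ∃ x : ℝ, ∀ (i : ℕ) (hi : i < w.length),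
    (ietMap π L)^[i + 1] x ∈
      Set.Ico (leftEnd L (w.get ⟨i, hi⟩)) (leftEnd L (w.get ⟨i, hi⟩) + L (w.get ⟨i, hi⟩))

/-- `k`-alphabet mixing: there is `N` such that for any two allowed `k`-blocks `u, v`
and any `n > N` there is an allowed `n`-block beginning with `u` and ending with `v`. -/
def AlphabetMixing {d : ℕ} (π : Equiv.Perm (Fin d)) (L : Fin d → ℝ) (k : ℕ) : Prop :=
  ∃ N : ℕ, ∀ u v : List (Fin d), u.length = k → v.length = k →
    IsAllowedBlock π L u → IsAllowedBlock π L v →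
    ∀ n : ℕ, N < n → ∃ w : List (Fin d),
      w.length = n ∧ IsAllowedBlock π L w ∧ u <+: w ∧ v <:+ w

/-- `π'` is obtained from `π` by the Rauzy move of type `a`. -/
def RauzyMoveA {d : ℕ} [NeZero d] (π π' : Equiv.Perm (Fin d)) : Prop :=
  ∀ j : Fin d,
    ((j : ℕ) ≤ (π.symm (lastIdx d) : ℕ) → π' j = π j) ∧
    ((j : ℕ) = (π.symm (lastIdx d) : ℕ) + 1 → π' j = π (lastIdx d)) ∧
    ((π.symm (lastIdx d) : ℕ) + 1 < (j : ℕ) →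
      π' j = π ⟨(j : ℕ) - 1, lt_of_le_of_lt (Nat.sub_le _ _) j.isLt⟩)

/-- `π'` is obtained from `π` by the Rauzy move of type `b`. -/
def RauzyMoveB {d : ℕ} [NeZero d] (π π' : Equiv.Perm (Fin d)) : Prop :=
  ∀ j : Fin d,
    ((π j : ℕ) ≤ (π (lastIdx d) : ℕ) → π' j = π j) ∧
    ((π (lastIdx d) : ℕ) < (π j : ℕ) → (π j : ℕ) < d - 1 →
      (π' j : ℕ) = (π j : ℕ) + 1) ∧
    ((π j : ℕ) = d - 1 → (π' j : ℕ) = (π (lastIdx d) : ℕ) + 1)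

/-- `π` is in the Rauzy class of `π₀`: reachable by finitely many moves `a`, `b`. -/
def InRauzyClass {d : ℕ} [NeZero d] (π₀ π : Equiv.Perm (Fin d)) : Prop :=
  Relation.ReflTransGen (fun p q => RauzyMoveA p q ∨ RauzyMoveB p q) π₀ π

/-- The permutation `(4321)` on `{1,2,3,4}` (0-indexed: `j ↦ 3 - j`). -/
def perm4321 : Equiv.Perm (Fin 4) := ⟨![3, 2, 1, 0], ![3, 2, 1, 0], by decide, by decide⟩

/-- The permutation `(4213)` on `{1,2,3,4}`: `1↦4, 2↦2, 3↦1, 4↦3`. -/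
def perm4213 : Equiv.Perm (Fin 4) := ⟨![3, 1, 0, 2], ![2, 1, 3, 0], by decide, by decide⟩

/-- The combinatorial data of an interval exchange transformation:
a permutation together with a length vector. -/
structure IET (d : ℕ) where
  perm : Equiv.Perm (Fin d)
  len : Fin d → ℝ

/-- The first step of Rauzy induction on `T` is of type `a`, i.e.
`δ_max = δ_+` (equivalently `l_d < l_{π⁻¹ d}`). -/
def stepA {d : ℕ} [NeZero d] (T : IET d) : Prop :=
  T.len (lastIdx d) < T.len (T.perm.symm (lastIdx d))

/-- The first step of Rauzy induction on `T` is of type `b`, i.e.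
`δ_max = δ_-` (equivalently `l_{π⁻¹ d} < l_d`). -/
def stepB {d : ℕ} [NeZero d] (T : IET d) : Prop :=
  T.len (T.perm.symm (lastIdx d)) < T.len (lastIdx d)

/-- The length vector of `R(T)` after a type `a` step (the first return map of `T`
to `[0, δ_+)`, with intervals in their natural order). -/
noncomputable def lenAfterA {d : ℕ} [NeZero d] (π : Equiv.Perm (Fin d))
    (L : Fin d → ℝ) : Fin d → ℝ := fun j =>
  if (j : ℕ) < (π.symm (lastIdx d) : ℕ) then L j
  else if (j : ℕ) = (π.symm (lastIdx d) : ℕ) then L j - L (lastIdx d)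
  else if (j : ℕ) = (π.symm (lastIdx d) : ℕ) + 1 then L (lastIdx d)
  else L ⟨(j : ℕ) - 1, lt_of_le_of_lt (Nat.sub_le _ _) j.isLt⟩

/-- The length vector of `R(T)` after a type `b` step (the first return map of `T`
to `[0, δ_-)`). -/
noncomputable def lenAfterB {d : ℕ} [NeZero d] (π : Equiv.Perm (Fin d))
    (L : Fin d → ℝ) : Fin d → ℝ := fun j =>
  if j = lastIdx d then L j - L (π.symm (lastIdx d)) else L j

/-- `T'` is the result of one step of Rauzy induction applied to `T`
(`T' = R(T)`, un-rescaled). -/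
def IsRauzyStep {d : ℕ} [NeZero d] (T T' : IET d) : Prop :=
  (stepA T ∧ RauzyMoveA T.perm T'.perm ∧ T'.len = lenAfterA T.perm T.len) ∨
  (stepB T ∧ RauzyMoveB T.perm T'.perm ∧ T'.len = lenAfterB T.perm T.len)

/-- The matrix `M(T,1)` of a type `a` step. -/
def matA {d : ℕ} [NeZero d] (π : Equiv.Perm (Fin d)) : Matrix (Fin d) (Fin d) ℤ :=
  Matrix.of fun i j =>
    if (j : ℕ) ≤ (π.symm (lastIdx d) : ℕ) then (if i = j then 1 else 0)
    else if i = lastIdx d then (if (j : ℕ) = (π.symm (lastIdx d) : ℕ) + 1 then 1 else 0)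
    else if (i : ℕ) = (j : ℕ) - 1 then 1 else 0

/-- The matrix `M(T,1)` of a type `b` step. -/
def matB {d : ℕ} [NeZero d] (π : Equiv.Perm (Fin d)) : Matrix (Fin d) (Fin d) ℤ :=
  Matrix.of fun i j =>
    if i = lastIdx d ∧ j = π.symm (lastIdx d) then 1 else if i = j then 1 else 0

open Classical in
/-- The matrix `M(T,1)` of the first step of Rauzy induction on `T`. -/
noncomputable def stepMat {d : ℕ} [NeZero d] (T : IET d) : Matrix (Fin d) (Fin d) ℤ :=
  if stepA T then matA T.perm else matB T.perm

/-- A run of `n` steps of Rauzy induction: `seq 0 = T`, `seq (i+1) = R(seq i)`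
for `i < n`.  `T` admits `n` steps of Rauzy induction iff such a chain starting
at `T` exists. -/
structure RauzyChain (d : ℕ) [NeZero d] (n : ℕ) where
  seq : ℕ → IET d
  step : ∀ i, i < n → IsRauzyStep (seq i) (seq (i + 1))

/-- The matrix `M(R^a(T), m)` of the steps `a, a+1, …, a+m-1` of a chain. -/
noncomputable def chainMatrixFrom {d n : ℕ} [NeZero d] (c : RauzyChain d n)
    (a m : ℕ) : Matrix (Fin d) (Fin d) ℤ :=
  ((List.range m).map fun i => stepMat (c.seq (a + i))).prod

/-- The matrix `M(T, m)` of the first `m` steps of a chain starting at `T`. -/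
noncomputable def chainMatrix {d n : ℕ} [NeZero d] (c : RauzyChain d n)
    (m : ℕ) : Matrix (Fin d) (Fin d) ℤ :=
  chainMatrixFrom c 0 m

/-- `|C_j(M)|`, the sum of the entries of the `j`-th column of `M`. -/
def colSum {d : ℕ} (M : Matrix (Fin d) (Fin d) ℤ) (j : Fin d) : ℤ := ∑ i, M i j

/-- `M_Δ = M ℝ₊^d ∩ Δ̊_{d-1}`: positive vectors of the cone of `M` lying in the
interior of the standard simplex. -/
def matSimplex {d : ℕ} (M : Matrix (Fin d) (Fin d) ℤ) : Set (Fin d → ℝ) :=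
  {L | (∃ v : Fin d → ℝ, (∀ i, 0 ≤ v i) ∧ L = (M.map (Int.cast : ℤ → ℝ)).mulVec v) ∧
       (∀ i, 0 < L i) ∧ ∑ i, L i = 1}

/-- `u^n`, the `n`-fold concatenation of the word `u` with itself. -/
def wpow {α : Type*} (u : List α) (n : ℕ) : List α := (List.replicate n u).flatten

/-- Every residue class modulo `b` contains a multiple `i * a` with `i < b`, for `a` coprime
to `b`. -/
lemma exists_lt_mul_modEq {a b : ℕ} (ha : 0 < a) (hb : 0 < b) (hab : Nat.Coprime a b) (n : ℕ) :
    ∃ i < b, i * a ≡ n [MOD b] := by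
  obtain ⟨h0, h1⟩ := (Nat.chineseRemainder hab 0 n).2
  have hlt := Nat.chineseRemainder_lt_mul hab 0 n ha.ne' hb.ne'
  obtain ⟨i, hi⟩ := (Nat.modEq_zero_iff_dvd).1 h0
  rw [hi] at h1 hlt
  exact ⟨i, Nat.lt_of_mul_lt_mul_left hlt, by rwa [mul_comm]⟩

/-- A bounded version of the two-coin problem: away from both ends of `[0, N * (a + b)]`,
every number is a combination of `a` and `b` with coefficients at most `N`. -/
lemma exists_bounded_mul_add_mul {a b N n : ℕ} (ha : 0 < a) (hb : 0 < b)
    (hab : Nat.Coprime a b) (haN : a ≤ N) (hbN : b ≤ N) (h₁ : a * b ≤ n)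
    (h₂ : n + a * b ≤ N * (a + b)) :
    ∃ i j, i ≤ N ∧ j ≤ N ∧ n = i * a + j * b := by
  rcases le_total n (N * b) with h | h
  · obtain ⟨i, hi, hmod⟩ := exists_lt_mul_modEq ha hb hab n
    have hin : i * a ≤ n := by nlinarith
    obtain ⟨j, hj⟩ := (Nat.modEq_iff_dvd' hin).1 hmod
    refine ⟨i, j, by omega, ?_, by rw [mul_comm j b]; omega⟩
    refine Nat.le_of_mul_le_mul_right (c := b) ?_ hb
    rw [mul_comm j b]; omega
  · obtain ⟨d, rfl⟩ := Nat.exists_eq_add_of_le h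
    obtain ⟨k, hk, hmod⟩ := exists_lt_mul_modEq hb ha hab.symm ((a - 1) * d)
    have hdvd : a ∣ d + k * b := by
      rw [← Nat.modEq_zero_iff_dvd]
      refine (hmod.add_left d).trans ?_
      rw [Nat.modEq_zero_iff_dvd]
      obtain ⟨c, rfl⟩ := Nat.exists_eq_succ_of_ne_zero ha.ne'
      exact ⟨d, by simp; ring⟩
    obtain ⟨i, hi⟩ := hdvd
    obtain ⟨j, rfl⟩ := Nat.exists_eq_add_of_le (hk.le.trans haN)
    refine ⟨i, j, ?_, by omega, by nlinarith⟩
    refine Nat.le_of_mul_le_mul_left (c := a) ?_ ha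
    nlinarith

lemma wpow_add {α : Type*} (u : List α) (m n : ℕ) : wpow u (m + n) = wpow u m ++ wpow u n := by
  rw [wpow, List.replicate_add, List.flatten_append, wpow, wpow]

lemma wpow_one {α : Type*} (u : List α) : wpow u 1 = u := by
  simp [wpow]

lemma length_wpow {α : Type*} (u : List α) (n : ℕ) : (wpow u n).length = n * u.length := by
  simp [wpow]

/-- With `gcd(|B₂|,|B₃|) = 1`, `g = 2|B₂||B₃|`, `u` a factor of `B₂`
and `v` a factor of `B₃`, for every
`|W| + g + |B₂| + |B₃| ≤ r ≤ |W| + 5g|B₂| + 5g|B₃| - g - |B₂| - |B₃|` the word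
`B₂^{5g} W B₃^{5g}` has a factor `w` of length `r` of the form `w = u m v`. -/
theorem factor_u_m_v {α : Type*} (B₂ B₃ : List α)
    (h2 : B₂ ≠ []) (h3 : B₃ ≠ [])
    (hgcd : Nat.gcd B₂.length B₃.length = 1)
    (g : ℕ) (hg : g = 2 * B₂.length * B₃.length)
    (W : List α) (u v : List α) (hu : u <:+: B₂) (hv : v <:+: B₃)
    (r : ℕ) (hr1 : W.length + g + B₂.length + B₃.length ≤ r)
    (hr2 : (r : ℤ) ≤ (W.length : ℤ) + 5 * g * B₂.length + 5 * g * B₃.length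
      - g - B₂.length - B₃.length) :
    ∃ w m : List α, w.length = r ∧ w = u ++ m ++ v ∧
      w <:+: (wpow B₂ (5 * g) ++ W ++ wpow B₃ (5 * g)) := by
  obtain ⟨s, t, rfl⟩ := hu
  obtain ⟨p, q, rfl⟩ := hv
  have ha : 0 < (s ++ u ++ t).length := List.length_pos_of_ne_nil h2
  have hb : 0 < (p ++ v ++ q).length := List.length_pos_of_ne_nil h3
  have hla : u.length + t.length ≤ (s ++ u ++ t).length := by simp
  have hlb : p.length + v.length ≤ (p ++ v ++ q).length := by simp
  generalize hB₂ : s ++ u ++ t = B₂ at *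
  generalize hB₃ : p ++ v ++ q = B₃ at *
  set a := B₂.length with ha_def
  set b := B₃.length with hb_def
  have hag : a ≤ g := by nlinarith
  have hbg : b ≤ g := by nlinarith
  obtain ⟨N, hN⟩ : ∃ N, 5 * g = N + 1 := ⟨5 * g - 1, by omega⟩
  obtain ⟨n, rfl⟩ : ∃ n, r = W.length + (u.length + t.length) + (p.length + v.length) + n :=
    Nat.exists_eq_add_of_le (by omega)
  have hr2' : n + g + a + b ≤ 5 * g * a + 5 * g * b := by zify; push_cast at hr2; omega
  rw [hN] at hr2' ⊢
  obtain ⟨i, j, hi, hj, hn⟩ := exists_bounded_mul_add_mul (N := N) (n := n) ha hb hgcd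
    (by omega) (by omega) (by nlinarith) (by nlinarith)
  obtain ⟨i', rfl⟩ := Nat.exists_eq_add_of_le' hi
  obtain ⟨j', hj'⟩ := Nat.exists_eq_add_of_le hj
  have e₂ : wpow B₂ (i' + i + 1) = wpow B₂ i' ++ (s ++ u ++ t) ++ wpow B₂ i := by
    rw [show i' + i + 1 = i' + 1 + i by ring, wpow_add, wpow_add, wpow_one, hB₂]
  have e₃ : wpow B₃ (i' + i + 1) = wpow B₃ j ++ (p ++ v ++ q) ++ wpow B₃ j' := by
    rw [hj', show j + j' + 1 = j + 1 + j' by ring, wpow_add, wpow_add, wpow_one, hB₃]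
  refine ⟨_, t ++ wpow B₂ i ++ W ++ wpow B₃ j ++ p, ?_, rfl,
    wpow B₂ i' ++ s, q ++ wpow B₃ j', ?_⟩
  · simp only [List.length_append, length_wpow, ← ha_def, ← hb_def]
    omega
  · rw [e₂, e₃]
    simp only [List.append_assoc]

end IETPaper
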